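/- Let H = (V, E) be a finite hypergraph with maximum vertex degree Δ, maximum edge size ℓ, and average edge size ℓ̄ satisfying ℓ ≤ (1+ε)·ℓ̄ for some fixed ε ∈ [0, 1/2]. Let b_v ∈ ℕ with b_v ≤ d(v) for every vertex v, b := min_v b_v ≥ 3, Δ ≥ b + 2, δ := Δ − b + 1, and k_v := d(v) − b_v. If M is a k-matching in H with ℓ·|M| ≥ ν_k(H), then S := E \ M is a set multicover with |S| ≤ (5/6 − 1/(2ℓ)) · δ · Opt ≤ (5/6) · δ · Opt, where Opt is the minimum cardinality of a set multicover. -/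

import Mathlib

open Finset

/-- `M` is a `k`-matching: every vertex `v` lies in at most `k v` edges of `M`. -/
def IsKMatching {V ι : Type*} [DecidableEq V] (E : ι → Finset V) (k : V → ℕ)
    (M : Finset ι) : Prop :=
  ∀ v : V, (M.filter (fun i => v ∈ E i)).card ≤ k v

/-- `C` is a `b`-set multicover: every vertex `v` lies in at least `b v` edges of `C`. -/
def IsMulticover {V ι : Type*} [DecidableEq V] (E : ι → Finset V) (b : V → ℕ)
    (C : Finset ι) : Prop :=
  ∀ v : V, b v ≤ (C.filter (fun i => v ∈ E i)).card

/-- Double counting of incidences between the vertices and a set of edges. -/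
theorem sum_degree_eq_sum_card {V ι : Type*} [Fintype V] [DecidableEq V]
    (E : ι → Finset V) (C : Finset ι) :
    ∑ v : V, (C.filter (fun i => v ∈ E i)).card = ∑ i ∈ C, (E i).card := by
  simp only [card_filter]
  rw [sum_comm]
  simp

theorem card_filter_add_card_filter_compl {V ι : Type*} [Fintype ι] [DecidableEq V]
    [DecidableEq ι] (E : ι → Finset V) (C : Finset ι) (v : V) :
    (C.filter (fun i => v ∈ E i)).card + (Cᶜ.filter (fun i => v ∈ E i)).card =
      (univ.filter (fun i => v ∈ E i)).card := by
  rw [← card_union_of_disjoint (disjoint_filter_filter disjoint_compl_right), ← filter_union,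
    union_compl]

/-- The complement of a matching is a multicover. -/
theorem IsKMatching.isMulticover_compl {V ι : Type*} [Fintype ι] [DecidableEq V]
    [DecidableEq ι] {E : ι → Finset V} {b : V → ℕ} {M : Finset ι}
    (hbd : ∀ v : V, b v ≤ (univ.filter (fun i => v ∈ E i)).card)
    (hM : IsKMatching E (fun v => (univ.filter (fun i => v ∈ E i)).card - b v) M) :
    IsMulticover E b Mᶜ := fun v => by
  have h₁ := hM v
  have h₂ := hbd v
  have h₃ := card_filter_add_card_filter_compl E M v
  dsimp only at h₁
  omega

/-- The complement of a multicover is a matching. -/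
theorem IsMulticover.isKMatching_compl {V ι : Type*} [Fintype ι] [DecidableEq V]
    [DecidableEq ι] {E : ι → Finset V} {b : V → ℕ} {C : Finset ι}
    (hC : IsMulticover E b C) :
    IsKMatching E (fun v => (univ.filter (fun i => v ∈ E i)).card - b v) Cᶜ := fun v => by
  have h₁ := hC v
  have h₃ := card_filter_add_card_filter_compl E C v
  dsimp only
  omega

/-- A multicover contains at least a fraction `β / Δ` of all incidences when every demand is at
least `β`. -/
theorem IsMulticover.mul_sum_card_le {V ι : Type*} [Fintype V] [Fintype ι] [DecidableEq V]
    {E : ι → Finset V} {b : V → ℕ} {C : Finset ι} {Δ β : ℕ}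
    (hC : IsMulticover E b C) (hΔ : ∀ v : V, (univ.filter (fun i => v ∈ E i)).card ≤ Δ)
    (hβ : ∀ v, β ≤ b v) :
    β * ∑ i, (E i).card ≤ Δ * ∑ i ∈ C, (E i).card := by
  rw [← sum_degree_eq_sum_card E univ, ← sum_degree_eq_sum_card E C, mul_sum, mul_sum]
  refine sum_le_sum fun v _ => ?_
  rw [mul_comm]
  exact Nat.mul_le_mul (hΔ v) ((hβ v).trans (hC v))

/-- Corollary 2: for hypergraphs with `ℓ ≤ (1+ε)ℓ̄`, `ε ∈ [0,1/2]`, `b ≥ 3` and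
`Δ ≥ b + 2`, any `k`-matching `M` with `ℓ·|M| ≥ ν_k(H)` yields a set multicover
`S = E \ M` with `|S| ≤ (5/6 - 1/(2ℓ))·δ·Opt ≤ (5/6)·δ·Opt`. -/
theorem five_sixth_delta_approximation
    {V ι : Type*} [Fintype V] [Fintype ι] [DecidableEq V] [DecidableEq ι]
    [Nonempty V]
    (E : ι → Finset V) (Δ ℓ : ℕ)
    (hΔ : ∀ v : V, (univ.filter (fun i => v ∈ E i)).card ≤ Δ)
    (hℓ : ∀ i, (E i).card ≤ ℓ)
    (ε : ℝ) (hε0 : 0 ≤ ε) (hε1 : ε ≤ 1 / 2)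
    (hℓavg : (ℓ : ℝ) ≤ (1 + ε) * ((∑ i : ι, ((E i).card : ℝ)) / Fintype.card ι))
    (b : V → ℕ)
    (hbd : ∀ v : V, b v ≤ (univ.filter (fun i => v ∈ E i)).card)
    (bm : ℕ) (hbm : bm = univ.inf' univ_nonempty b)
    (hb3 : 3 ≤ bm) (hΔb : bm + 2 ≤ Δ)
    (M : Finset ι)
    (hM : IsKMatching E (fun v => (univ.filter (fun i => v ∈ E i)).card - b v) M)
    (hMν : sSup {c : ℕ | ∃ M' : Finset ι,
        IsKMatching E (fun v => (univ.filter (fun i => v ∈ E i)).card - b v) M' ∧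
        M'.card = c} ≤ ℓ * M.card) :
    IsMulticover E b Mᶜ ∧
    (Mᶜ.card : ℝ) ≤ (5 / 6 - 1 / (2 * ℓ)) * ((Δ : ℝ) - bm + 1) *
      (sInf {c : ℕ | ∃ C : Finset ι, IsMulticover E b C ∧ C.card = c} : ℕ) ∧
    (5 / 6 - 1 / (2 * ℓ)) * ((Δ : ℝ) - bm + 1) *
      (sInf {c : ℕ | ∃ C : Finset ι, IsMulticover E b C ∧ C.card = c} : ℕ) ≤
    5 / 6 * ((Δ : ℝ) - bm + 1) *
      (sInf {c : ℕ | ∃ C : Finset ι, IsMulticover E b C ∧ C.card = c} : ℕ) := by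
  have hβ : ∀ v, bm ≤ b v := fun v => hbm ▸ inf'_le b (mem_univ v)
  have hℓ1 : 1 ≤ ℓ := by
    obtain ⟨v⟩ := ‹Nonempty V›
    have hd : 0 < (univ.filter (fun i => v ∈ E i)).card := by
      have := hβ v
      have := hbd v
      omega
    obtain ⟨i, hi⟩ := card_pos.mp hd
    exact (card_pos.mpr ⟨v, (mem_filter.mp hi).2⟩).trans_le (hℓ i)
  have hm : 0 < Fintype.card ι := by
    rcases Nat.eq_zero_or_pos (Fintype.card ι) with h | h
    · rw [h] at hℓavg
      simp only [Nat.cast_zero, div_zero, mul_zero] at hℓavg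
      have : ℓ ≤ 0 := by exact_mod_cast hℓavg
      omega
    · exact h
  have hmem := Nat.sInf_mem (s := {c : ℕ | ∃ C : Finset ι, IsMulticover E b C ∧ C.card = c})
    ⟨_, univ, hbd, rfl⟩
  obtain ⟨C, hC, hCcard⟩ := hmem
  rw [← hCcard]
  have hℓR : (1 : ℝ) ≤ ℓ := by exact_mod_cast hℓ1
  have hbR : (3 : ℝ) ≤ bm := by exact_mod_cast hb3
  have hΔR : (bm : ℝ) + 2 ≤ Δ := by exact_mod_cast hΔb
  have hmR : (0 : ℝ) < Fintype.card ι := by exact_mod_cast hm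
  have hC0 : (0 : ℝ) ≤ C.card := Nat.cast_nonneg _
  refine ⟨hM.isMulticover_compl hbd, ?_, ?_⟩
  · have hν : Cᶜ.card ≤ ℓ * M.card := by
      refine hMν.trans' (le_csSup ⟨Fintype.card ι, ?_⟩ ⟨Cᶜ, hC.isKMatching_compl, rfl⟩)
      rintro _ ⟨M', -, rfl⟩
      exact card_le_univ M'
    have hνR : (Cᶜ.card : ℝ) ≤ ℓ * M.card := by exact_mod_cast hν
    have hCc : (C.card : ℝ) + Cᶜ.card = Fintype.card ι := by
      exact_mod_cast card_add_card_compl C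
    have hMc : (M.card : ℝ) + Mᶜ.card = Fintype.card ι := by
      exact_mod_cast card_add_card_compl M
    have hinc : (bm : ℝ) * ∑ i, ((E i).card : ℝ) ≤ Δ * (ℓ * C.card) := by
      have h := (hC.mul_sum_card_le hΔ hβ).trans
        (Nat.mul_le_mul_left Δ (sum_le_card_nsmul C _ ℓ fun i _ => hℓ i))
      rw [smul_eq_mul, mul_comm C.card] at h
      exact_mod_cast h
    have hS0 : (0 : ℝ) ≤ ∑ i, ((E i).card : ℝ) := sum_nonneg fun _ _ => Nat.cast_nonneg _
    have havg : (ℓ : ℝ) * Fintype.card ι ≤ 3 / 2 * ∑ i, ((E i).card : ℝ) := by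
      rw [← mul_div_assoc, le_div_iff₀ hmR] at hℓavg
      exact hℓavg.trans (mul_le_mul_of_nonneg_right (by linarith) hS0)
    have hedges : (bm : ℝ) * Fintype.card ι ≤ 3 / 2 * Δ * C.card := by
      refine le_of_mul_le_mul_left ?_ (show (0 : ℝ) < ℓ by linarith)
      nlinarith [mul_le_mul_of_nonneg_left havg (show (0 : ℝ) ≤ bm by linarith)]
    have hedges' : (Fintype.card ι : ℝ) ≤ ((Δ : ℝ) - bm + 3) / 2 * C.card := by
      refine le_of_mul_le_mul_left (hedges.trans ?_) (show (0 : ℝ) < bm by linarith)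
      nlinarith [mul_nonneg (mul_nonneg (show (0 : ℝ) ≤ bm - 3 by linarith)
        (show (0 : ℝ) ≤ Δ - bm by linarith)) hC0]
    refine le_of_mul_le_mul_left ?_ (show (0 : ℝ) < ℓ by linarith)
    have hrw : (ℓ : ℝ) * ((5 / 6 - 1 / (2 * ℓ)) * ((Δ : ℝ) - bm + 1) * C.card) =
        (5 / 6 * ℓ - 1 / 2) * ((Δ : ℝ) - bm + 1) * C.card := by
      field_simp
    rw [hrw]
    nlinarith [mul_le_mul_of_nonneg_left hedges' (show (0 : ℝ) ≤ ℓ - 1 by linarith),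
      mul_nonneg (mul_nonneg (show (0 : ℝ) ≤ ℓ by linarith)
        (show (0 : ℝ) ≤ Δ - bm - 2 by linarith)) hC0]
  · gcongr
    · linarith
    · exact sub_le_self _ (by positivity)
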